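/- Let (a,b) ∈ ℝ/ℤ × [0,1] be a parameter not in the closure of the hyperbolic set H. Then the semiconjugacy φ_{a,b} is a homeomorphism of ℝ/ℤ, and it conjugates f_{a,b} with the doubling map: φ_{a,b} ∘ f_{a,b} = D ∘ φ_{a,b}. -/

import Mathlib

open Set Filter Topology

noncomputable section

/-- Representative of a point of the circle in `[0,1)`. -/
noncomputable def rep (z : UnitAddCircle) : ℝ := (AddCircle.equivIco 1 0 z).val

/-- The straight sine map on `[0,1)`. -/
noncomputable def Sfun (t : ℝ) : ℝ := if t ≤ 1/2 then 4*t - 1 else -4*t + 3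

/-- The piecewise linear perturbation of the doubling map. -/
noncomputable def plpdm (a : UnitAddCircle) (b : ℝ) (z : UnitAddCircle) : UnitAddCircle :=
  ((2 * rep z + (b/2) * Sfun (rep z) : ℝ) : UnitAddCircle) + a

/-- The doubling map. -/
def Dbl (z : UnitAddCircle) : UnitAddCircle := z + z

/-- `x` is an attracting periodic point of `f` of exact period `n`. -/
def IsAttractingPeriodicPt (f : UnitAddCircle → UnitAddCircle) (n : ℕ)
    (x : UnitAddCircle) : Prop :=
  0 < n ∧ f^[n] x = x ∧ (∀ m, 0 < m → m < n → f^[m] x ≠ x) ∧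
  ∃ U : Set UnitAddCircle, IsOpen U ∧ IsConnected U ∧ x ∈ U ∧ f^[n] '' U ⊆ U ∧
    ∀ y ∈ U, Tendsto (fun k => f^[n*k] y) atTop (nhds x)

/-- Forward orbit of `x` under `f`. -/
def orbitSet (f : UnitAddCircle → UnitAddCircle) (x : UnitAddCircle) : Set UnitAddCircle :=
  {y | ∃ i, f^[i] x = y}

/-- Basin of attraction of the set `O`. -/
def basin (f : UnitAddCircle → UnitAddCircle) (O : Set UnitAddCircle) : Set UnitAddCircle :=
  {y | Tendsto (fun k => Metric.infDist (f^[k] y) O) atTop (nhds 0)}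

/-- Immediate basin of attraction of the orbit `O`. -/
def immBasin (f : UnitAddCircle → UnitAddCircle) (O : Set UnitAddCircle) :
    Set UnitAddCircle :=
  ⋃ z ∈ O, connectedComponentIn (basin f O) z

/-- The hyperbolic set `H`. -/
def hypSet : Set (UnitAddCircle × ℝ) :=
  {q | q.2 ∈ Set.Ico (0:ℝ) 1 ∧ ∃ n x, IsAttractingPeriodicPt (plpdm q.1 q.2) n x}

/-- The lift `F_{a,b}` of `f_{a,b}`, normalized so that `F_{a,b}(0) ∈ [0,1)`. -/
noncomputable def liftF (a : UnitAddCircle) (b : ℝ) (x : ℝ) : ℝ :=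
  (2 * Int.fract x + rep a + (b/2) * Sfun (Int.fract x)
    + (if rep a - b/2 < 0 then 1 else 0)) + 2 * (⌊x⌋ : ℝ)

/-- `Φ_{a,b}`, the limit of `F_{a,b}^n(x)/2^n`. -/
noncomputable def Phi (a : UnitAddCircle) (b : ℝ) (x : ℝ) : ℝ :=
  limUnder atTop (fun n : ℕ => (liftF a b)^[n] x / 2 ^ n)

/-- The semiconjugacy `φ_{a,b}` induced by `Φ_{a,b}`. -/
noncomputable def phiMap (a : UnitAddCircle) (b : ℝ) (z : UnitAddCircle) : UnitAddCircle :=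
  ((Phi a b (rep z) : ℝ) : UnitAddCircle)

/-- The arc `I₊ = [0,1/2]` of the circle. -/
def Iplus : Set UnitAddCircle := (fun t : ℝ => (t : UnitAddCircle)) '' Set.Icc 0 (1/2)

/-- The arc `I₋ = [1/2,1]` of the circle. -/
def Iminus : Set UnitAddCircle := (fun t : ℝ => (t : UnitAddCircle)) '' Set.Icc (1/2) 1

/-- The orbit of `x` (of period `p`) avoids `0`, `1/2` and has slope itinerary `σ`,
where `σ j = true` encodes the symbol `−` and `σ j = false` encodes `+`. -/
def HasItinerary (f : UnitAddCircle → UnitAddCircle) (p : ℕ) (x : UnitAddCircle)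
    (σ : Fin p → Bool) : Prop :=
  (∀ j : Fin p, f^[(j : ℕ)] x ≠ (0 : UnitAddCircle) ∧
      f^[(j : ℕ)] x ≠ (((1:ℝ)/2 : ℝ) : UnitAddCircle)) ∧
  ∀ j : Fin p, (σ j = true → f^[(j : ℕ)] x ∈ Iminus) ∧ (σ j = false → f^[(j : ℕ)] x ∈ Iplus)

/-- The set `P_σ` of parameters whose attracting orbit has slope itinerary `σ`. -/
def paramSet (p : ℕ) (σ : Fin p → Bool) : Set (UnitAddCircle × ℝ) :=
  {q | q.2 ∈ Set.Ico (0:ℝ) 1 ∧ ∃ x, IsAttractingPeriodicPt (plpdm q.1 q.2) p x ∧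
       HasItinerary (plpdm q.1 q.2) p x σ}

/-- `S` is a tongue: its closure meets `ℝ/ℤ × {1}` in a nondegenerate interval. -/
def IsTongue (S : Set (UnitAddCircle × ℝ)) : Prop :=
  ∃ u v : ℝ, u < v ∧ ∀ t ∈ Set.Icc u v, (((t : ℝ) : UnitAddCircle), (1:ℝ)) ∈ closure S

end

/-- The lift of `plpdm` with real translation parameter `α`. -/
noncomputable def pdLift (α b x : ℝ) : ℝ := 2 * x + α + b * (2 * ‖(x : UnitAddCircle)‖ - 1 / 2)

section Basic

variable {α b : ℝ}

lemma norm_coe_of_abs_le {x : ℝ} (k : ℤ) (h : |x - k| ≤ 1 / 2) :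
    ‖(x : UnitAddCircle)‖ = |x - k| := by
  have h1 : ((x - k : ℝ) : UnitAddCircle) = x := by
    rw [AddCircle.coe_sub, sub_eq_self, AddCircle.coe_eq_zero_iff]
    exact ⟨k, by simp⟩
  rw [← h1, AddCircle.norm_coe_eq_abs_iff 1 one_ne_zero]
  simpa using h

lemma Sfun_fract (x : ℝ) : Sfun (Int.fract x) = 4 * ‖(x : UnitAddCircle)‖ - 1 := by
  have h0 := Int.fract_nonneg x
  have h1 := Int.fract_lt_one x
  have h2 : x = ⌊x⌋ + Int.fract x := (Int.floor_add_fract x).symm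
  unfold Sfun
  split_ifs with h
  · rw [norm_coe_of_abs_le ⌊x⌋] <;> rw [← Int.fract, abs_of_nonneg h0]
    exact h
  · push Not at h
    have : |x - ((⌊x⌋ + 1 : ℤ) : ℝ)| = 1 - Int.fract x := by
      push_cast
      rw [abs_of_neg (by linarith)]
      linarith
    rw [norm_coe_of_abs_le (⌊x⌋ + 1)] <;> rw [this]
    · ring
    · linarith

lemma rep_coe (x : ℝ) : rep (x : UnitAddCircle) = Int.fract x := by
  have := AddCircle.coe_equivIco_mk_apply (1 : ℝ) x
  rwa [div_one, mul_one] at this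

lemma coe_rep (z : UnitAddCircle) : ((rep z : ℝ) : UnitAddCircle) = z :=
  AddCircle.coe_equivIco

lemma plpdm_coe (α b x : ℝ) : plpdm (α : UnitAddCircle) b x = (pdLift α b x : ℝ) := by
  unfold plpdm pdLift
  rw [rep_coe, Sfun_fract, ← AddCircle.coe_add, ← sub_eq_zero, ← AddCircle.coe_sub,
    AddCircle.coe_eq_zero_iff]
  refine ⟨-(2 * ⌊x⌋), ?_⟩
  have h2 : x = ⌊x⌋ + Int.fract x := (Int.floor_add_fract x).symm
  generalize ‖(x : UnitAddCircle)‖ = N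
  simp only [zsmul_eq_mul, mul_one]
  push_cast
  linear_combination 2 * h2

lemma iterate_plpdm_coe (α b x : ℝ) (n : ℕ) :
    (plpdm (α : UnitAddCircle) b)^[n] x = ((pdLift α b)^[n] x : ℝ) := by
  induction n with
  | zero => rfl
  | succ n ih => rw [Function.iterate_succ_apply', Function.iterate_succ_apply', ih, plpdm_coe]

lemma liftF_eq (a : UnitAddCircle) (b : ℝ) :
    liftF a b = pdLift (rep a + if rep a - b / 2 < 0 then 1 else 0) b := by
  funext x
  unfold liftF pdLift
  rw [Sfun_fract]
  have h2 : x = ⌊x⌋ + Int.fract x := (Int.floor_add_fract x).symm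
  linear_combination -2 * h2

lemma coe_add_int (x : ℝ) (k : ℤ) : ((x + k : ℝ) : UnitAddCircle) = x := by
  rw [AddCircle.coe_add, add_eq_left, AddCircle.coe_eq_zero_iff]
  exact ⟨k, by simp⟩

lemma coe_eq_coe_iff_int {x y : ℝ} :
    (x : UnitAddCircle) = y ↔ ∃ k : ℤ, x = y + k := by
  rw [← sub_eq_zero, ← AddCircle.coe_sub, AddCircle.coe_eq_zero_iff]
  constructor
  · rintro ⟨k, hk⟩
    exact ⟨k, by simp at hk; linarith⟩
  · rintro ⟨k, hk⟩
    exact ⟨k, by simp; linarith⟩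

lemma pdLift_add_int (α b x : ℝ) (k : ℤ) : pdLift α b (x + k) = pdLift α b x + 2 * k := by
  unfold pdLift
  rw [coe_add_int]
  ring

lemma iterate_pdLift_add_int (α b x : ℝ) (k : ℤ) (n : ℕ) :
    (pdLift α b)^[n] (x + k) = (pdLift α b)^[n] x + 2 ^ n * k := by
  induction n with
  | zero => simp
  | succ n ih =>
    rw [Function.iterate_succ_apply', ih, Function.iterate_succ_apply']
    have := pdLift_add_int α b ((pdLift α b)^[n] x) (2 ^ n * k)
    push_cast at this
    rw [this]
    ring

lemma continuous_pdLift_prod : Continuous fun q : (ℝ × ℝ) × ℝ => pdLift q.1.1 q.1.2 q.2 := by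
  unfold pdLift
  have : Continuous fun q : (ℝ × ℝ) × ℝ => ‖(q.2 : UnitAddCircle)‖ :=
    ((AddCircle.continuous_mk' 1).comp continuous_snd).norm
  fun_prop

lemma continuous_iterate_pdLift_prod (n : ℕ) :
    Continuous fun q : (ℝ × ℝ) × ℝ => (pdLift q.1.1 q.1.2)^[n] q.2 := by
  induction n with
  | zero => exact continuous_snd
  | succ n ih =>
    simp only [Function.iterate_succ_apply']
    exact continuous_pdLift_prod.comp (continuous_fst.prodMk ih)

lemma continuous_iterate_pdLift (α b : ℝ) (n : ℕ) : Continuous (pdLift α b)^[n] :=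
  (continuous_iterate_pdLift_prod n).comp (by fun_prop : Continuous fun x : ℝ => ((α, b), x))

lemma pdLift_sub_le (hb : 0 ≤ b) {x y : ℝ} (h : x ≤ y) :
    (2 - 2 * b) * (y - x) ≤ pdLift α b y - pdLift α b x := by
  unfold pdLift
  have h1 : ‖(x : UnitAddCircle)‖ - ‖(y : UnitAddCircle)‖ ≤ y - x := by
    refine (norm_sub_norm_le _ _).trans ?_
    rw [← AddCircle.coe_sub, UnitAddCircle.norm_eq]
    refine (round_le (x - y) 0).trans ?_
    rw [Int.cast_zero, sub_zero, abs_sub_comm, abs_of_nonneg (by linarith)]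
  nlinarith

lemma pdLift_mono (hb : b ∈ Icc (0 : ℝ) 1) : Monotone (pdLift α b) := fun x y h => by
  have := pdLift_sub_le (α := α) hb.1 h
  nlinarith [hb.2]

lemma pdLift_strictMono (hb : b ∈ Ico (0 : ℝ) 1) : StrictMono (pdLift α b) := fun x y h => by
  have := pdLift_sub_le (α := α) hb.1 h.le
  nlinarith [hb.2]

lemma iterate_pdLift_add_le (hb : b ∈ Icc (0 : ℝ) 1) {t : ℝ} (ht : 0 ≤ t) {n : ℕ} (hn : 0 < n)
    (x : ℝ) : (pdLift α b)^[n] x + t ≤ (pdLift (α + t) b)^[n] x := by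
  have key : ∀ y, pdLift (α + t) b y = pdLift α b y + t := fun y => by unfold pdLift; ring
  induction n, hn using Nat.le_induction with
  | base => simp [key]
  | succ n hn ih =>
    rw [Function.iterate_succ_apply', Function.iterate_succ_apply', key]
    have := pdLift_mono (α := α) hb (show (pdLift α b)^[n] x ≤ (pdLift (α + t) b)^[n] x by linarith)
    linarith

lemma iterate_pdLift_le (hb : b ∈ Icc (0 : ℝ) 1) {t : ℝ} (ht : 0 ≤ t) (n : ℕ)
    (x : ℝ) : (pdLift α b)^[n] x ≤ (pdLift (α + t) b)^[n] x := by
  rcases n.eq_zero_or_pos with rfl | hn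
  · rfl
  · linarith [iterate_pdLift_add_le (α := α) hb ht hn x]

lemma pdLift_of_mem_left {k : ℤ} {z : ℝ} (h1 : k ≤ z) (h2 : z ≤ k + 1 / 2) :
    pdLift α b z = (2 + 2 * b) * z + (α - b / 2 - 2 * b * k) := by
  unfold pdLift
  have h3 : |z - k| = z - k := abs_of_nonneg (by linarith)
  rw [norm_coe_of_abs_le k (by rw [h3]; linarith), h3]
  ring

lemma pdLift_of_mem_right {k : ℤ} {z : ℝ} (h1 : k + 1 / 2 ≤ z) (h2 : z ≤ k + 1) :
    pdLift α b z = (2 - 2 * b) * z + (α - b / 2 + 2 * b * (k + 1)) := by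
  unfold pdLift
  have h3 : |z - (k + 1 : ℤ)| = k + 1 - z := by
    push_cast
    rw [abs_of_nonpos (by linarith)]
    ring
  rw [norm_coe_of_abs_le (k + 1) (by rw [h3]; linarith), h3]
  ring

lemma pdLift_slope_le (hb : 0 ≤ b) {k : ℤ} {x y l r : ℝ} (hx : k - 1 / 2 ≤ x) (hxy : x ≤ y)
    (hyl : y ≤ l) (hlr : l ≤ r) (hr : r ≤ k + 1 / 2) :
    (pdLift α b y - pdLift α b x) * (r - l) ≤ (pdLift α b r - pdLift α b l) * (y - x) := by
  have key : ∀ z : ℝ, k - 1 / 2 ≤ z → z ≤ k + 1 / 2 →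
      pdLift α b z = 2 * z + α + b * (2 * |z - k| - 1 / 2) := fun z h1 h2 => by
    unfold pdLift
    rw [norm_coe_of_abs_le k (abs_le.2 ⟨by linarith, by linarith⟩)]
  rw [key x hx (by linarith), key y (by linarith) (by linarith), key l (by linarith) (by linarith),
    key r (by linarith) hr]
  have h : (|y - k| - |x - k|) * (r - l) ≤ (|r - k| - |l - k|) * (y - x) := by
    rcases le_total (l : ℝ) k with h | h
    · have h3 : |l - k| = k - l := by rw [abs_of_nonpos (by linarith)]; ring
      have h4 : |y - k| = k - y := by rw [abs_of_nonpos (by linarith)]; ring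
      have h5 : |x - k| = k - x := by rw [abs_of_nonpos (by linarith)]; ring
      have h6 := neg_abs_le (r - k)
      rw [h3, h4, h5]
      nlinarith [mul_nonneg (sub_nonneg.2 hxy) (sub_nonneg.2 hlr)]
    · have h3 : |l - k| = l - k := by rw [abs_of_nonneg (by linarith)]
      have h4 : |r - k| = r - k := by rw [abs_of_nonneg (by linarith)]
      have h5 : |y - k| - |x - k| ≤ y - x := by
        have := abs_sub_abs_le_abs_sub (y - k) (x - k)
        rw [sub_sub_sub_cancel_right, abs_of_nonneg (sub_nonneg.2 hxy)] at this
        exact this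
      rw [h3, h4]
      nlinarith [mul_le_mul_of_nonneg_right h5 (sub_nonneg.2 hlr)]
  nlinarith [mul_le_mul_of_nonneg_left h hb]

end Basic

/-- The limit of the rescaled iterates of `pdLift`. -/
noncomputable def pdPhi (α b x : ℝ) : ℝ := limUnder atTop fun n : ℕ => (pdLift α b)^[n] x / 2 ^ n

section Semiconjugacy

variable {α b : ℝ}

lemma Phi_eq (a : UnitAddCircle) (b : ℝ) :
    Phi a b = pdPhi (rep a + if rep a - b / 2 < 0 then 1 else 0) b := by
  funext x
  unfold Phi pdPhi
  rw [liftF_eq]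

lemma abs_pdLift_sub_le (α b x : ℝ) : |pdLift α b x - 2 * x| ≤ |α| + |b| := by
  unfold pdLift
  have h1 := norm_nonneg (x : UnitAddCircle)
  have h2 := AddCircle.norm_le_half_period 1 (x := (x : UnitAddCircle)) one_ne_zero
  rw [abs_one] at h2
  have h3 : |2 * ‖(x : UnitAddCircle)‖ - 1 / 2| ≤ 1 := abs_le.2 ⟨by linarith, by linarith⟩
  calc _ = |α + b * (2 * ‖(x : UnitAddCircle)‖ - 1 / 2)| := by congr 1; ring
    _ ≤ |α| + |b * (2 * ‖(x : UnitAddCircle)‖ - 1 / 2)| := abs_add_le _ _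
    _ ≤ |α| + |b| := by
      rw [abs_mul]
      nlinarith [abs_nonneg b]

lemma dist_iterate_div_le (α b x : ℝ) (n : ℕ) :
    dist ((pdLift α b)^[n] x / 2 ^ n) ((pdLift α b)^[n + 1] x / 2 ^ (n + 1)) ≤
      (|α| + |b|) / 2 / 2 ^ n := by
  have h := abs_pdLift_sub_le α b ((pdLift α b)^[n] x)
  rw [Function.iterate_succ_apply', dist_comm, Real.dist_eq]
  have : pdLift α b ((pdLift α b)^[n] x) / 2 ^ (n + 1) - (pdLift α b)^[n] x / 2 ^ n =
      (pdLift α b ((pdLift α b)^[n] x) - 2 * (pdLift α b)^[n] x) / 2 ^ (n + 1) := by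
    field_simp
    ring
  rw [this, abs_div, abs_of_pos (by positivity : (0 : ℝ) < 2 ^ (n + 1)), pow_succ', div_div]
  gcongr

lemma tendsto_pdPhi (α b x : ℝ) :
    Tendsto (fun n : ℕ => (pdLift α b)^[n] x / 2 ^ n) atTop (𝓝 (pdPhi α b x)) :=
  (cauchySeq_of_le_geometric_two (dist_iterate_div_le α b x)).tendsto_limUnder

lemma abs_pdPhi_sub_le (α b x : ℝ) : |pdPhi α b x - x| ≤ |α| + |b| := by
  have := dist_le_of_le_geometric_two_of_tendsto₀ (dist_iterate_div_le α b x) (tendsto_pdPhi α b x)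
  rw [dist_comm, Real.dist_eq] at this
  simpa using this

lemma pdPhi_pdLift (α b x : ℝ) : pdPhi α b (pdLift α b x) = 2 * pdPhi α b x := by
  refine tendsto_nhds_unique (tendsto_pdPhi α b _) ?_
  refine (((tendsto_pdPhi α b x).comp (tendsto_add_atTop_nat 1)).const_mul 2).congr fun n => ?_
  simp only [Function.comp_apply, Function.iterate_succ_apply, pow_succ]
  field_simp

lemma pdPhi_iterate (α b x : ℝ) (n : ℕ) :
    pdPhi α b ((pdLift α b)^[n] x) = 2 ^ n * pdPhi α b x := by
  induction n with
  | zero => simp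
  | succ n ih => rw [Function.iterate_succ_apply', pdPhi_pdLift, ih]; ring

lemma pdPhi_add_int (α b x : ℝ) (k : ℤ) : pdPhi α b (x + k) = pdPhi α b x + k := by
  refine tendsto_nhds_unique (tendsto_pdPhi α b _) ?_
  refine ((tendsto_pdPhi α b x).add_const (k : ℝ)).congr fun n => ?_
  rw [iterate_pdLift_add_int]
  field_simp

lemma pdPhi_mono (hb : b ∈ Icc (0 : ℝ) 1) : Monotone (pdPhi α b) := fun x y h =>
  le_of_tendsto_of_tendsto' (tendsto_pdPhi α b x) (tendsto_pdPhi α b y) fun n => by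
    gcongr
    exact (pdLift_mono hb).iterate n h

lemma continuous_pdPhi (α b : ℝ) : Continuous (pdPhi α b) := by
  have h : TendstoUniformly (fun (n : ℕ) x => (pdLift α b)^[n] x / 2 ^ n) (pdPhi α b) atTop := by
    rw [Metric.tendstoUniformly_iff]
    intro ε hε
    have h0 : Tendsto (fun n : ℕ => (|α| + |b|) * (1 / 2) ^ n) atTop (𝓝 ((|α| + |b|) * 0)) :=
      (tendsto_pow_atTop_nhds_zero_of_lt_one (by norm_num) (by norm_num)).const_mul _
    rw [mul_zero] at h0
    filter_upwards [h0.eventually_lt_const hε] with n hn x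
    refine lt_of_le_of_lt ?_ hn
    have h1 := abs_pdPhi_sub_le α b ((pdLift α b)^[n] x)
    rw [pdPhi_iterate] at h1
    have h2 : pdPhi α b x - (pdLift α b)^[n] x / 2 ^ n =
        (2 ^ n * pdPhi α b x - (pdLift α b)^[n] x) * (1 / 2) ^ n := by
      rw [one_div, inv_pow]
      field_simp
    rw [Real.dist_eq, h2, abs_mul, abs_of_pos (by positivity : (0 : ℝ) < (1 / 2) ^ n)]
    gcongr
  exact h.continuous (Frequently.of_forall fun n => (continuous_iterate_pdLift α b n).div_const _)

lemma phiMap_coe (a : UnitAddCircle) (b x : ℝ) :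
    phiMap a b (x : UnitAddCircle) = (Phi a b x : ℝ) := by
  unfold phiMap
  rw [rep_coe, coe_eq_coe_iff_int, Phi_eq]
  refine ⟨-⌊x⌋, ?_⟩
  rw [← pdPhi_add_int, Int.fract]
  push_cast
  rfl

lemma plpdm_coe_liftF (a : UnitAddCircle) (b x : ℝ) :
    plpdm a b (x : UnitAddCircle) = (liftF a b x : ℝ) := by
  rw [liftF_eq, ← plpdm_coe, AddCircle.coe_add, coe_rep]
  split_ifs <;> simp [AddCircle.coe_period]

lemma phiMap_comp_plpdm (a : UnitAddCircle) (b : ℝ) :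
    phiMap a b ∘ plpdm a b = Dbl ∘ phiMap a b := by
  funext z
  obtain ⟨x, rfl⟩ := QuotientAddGroup.mk_surjective z
  change phiMap a b (plpdm a b (x : UnitAddCircle)) = Dbl (phiMap a b (x : UnitAddCircle))
  rw [plpdm_coe_liftF, phiMap_coe, phiMap_coe, Dbl, ← AddCircle.coe_add, liftF_eq, Phi_eq,
    pdPhi_pdLift, two_mul]

lemma exists_homeomorph_phiMap (a : UnitAddCircle) (b : ℝ)
    (hinj : Function.Injective (Phi a b)) :
    ∃ e : UnitAddCircle ≃ₜ UnitAddCircle, ⇑e = phiMap a b := by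
  have hcont : Continuous (Phi a b) := by rw [Phi_eq]; exact continuous_pdPhi _ _
  have hc : Continuous (phiMap a b) := by
    rw [(QuotientAddGroup.isQuotientMap_mk (AddSubgroup.zmultiples (1 : ℝ))).continuous_iff]
    exact ((AddCircle.continuous_mk' 1).comp hcont).congr fun x => (phiMap_coe a b x).symm
  have hsurj : Function.Surjective (Phi a b) := by
    rw [Phi_eq] at hcont ⊢
    generalize (rep a + if rep a - b / 2 < 0 then 1 else 0 : ℝ) = α at *
    refine hcont.surjective ?_ ?_
    · refine tendsto_atTop_mono (fun x => ?_) (tendsto_atTop_add_const_right _ (-(|α| + |b|)) tendsto_id)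
      have := abs_le.1 (abs_pdPhi_sub_le α b x)
      simp only [id]
      linarith
    · refine tendsto_atBot_mono (fun x => ?_) (tendsto_atBot_add_const_right _ (|α| + |b|) tendsto_id)
      have := abs_le.1 (abs_pdPhi_sub_le α b x)
      simp only [id]
      linarith
  have hbij : Function.Bijective (phiMap a b) := by
    constructor
    · intro z w h
      obtain ⟨x, rfl⟩ := QuotientAddGroup.mk_surjective z
      obtain ⟨y, rfl⟩ := QuotientAddGroup.mk_surjective w
      change phiMap a b (x : UnitAddCircle) = phiMap a b (y : UnitAddCircle) at h
      rw [phiMap_coe, phiMap_coe, coe_eq_coe_iff_int] at h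
      obtain ⟨k, hk⟩ := h
      refine coe_eq_coe_iff_int.2 ⟨k, hinj ?_⟩
      rw [hk, Phi_eq, pdPhi_add_int]
    · intro w
      obtain ⟨y, rfl⟩ := QuotientAddGroup.mk_surjective w
      obtain ⟨x, rfl⟩ := hsurj y
      exact ⟨(x : UnitAddCircle), phiMap_coe a b x⟩
  exact ⟨Continuous.homeoOfEquivCompactToT2 (f := Equiv.ofBijective _ hbij) hc, rfl⟩

end Semiconjugacy

section Attraction

lemma tendsto_iterate_of_lt {g : ℝ → ℝ} (hg : Monotone g) (hc : Continuous g) {x₀ e : ℝ}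
    (h0 : g x₀ = x₀) (h : ∀ z ∈ Ioo x₀ e, g z < z) {z : ℝ} (hz : z ∈ Ioo x₀ e) :
    Tendsto (fun k => g^[k] z) atTop (𝓝 x₀) := by
  have hanti : Antitone fun k => g^[k] z :=
    hg.antitone_iterate_of_map_le (h z hz).le
  have hlow : ∀ k, x₀ ≤ g^[k] z := fun k => by
    have := hg.iterate k hz.1.le
    rwa [Function.iterate_fixed h0] at this
  have hbdd : BddBelow (range fun k => g^[k] z) := ⟨x₀, by rintro _ ⟨k, rfl⟩; exact hlow k⟩
  have hlim := tendsto_atTop_ciInf hanti hbdd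
  have hfix := isFixedPt_of_tendsto_iterate hlim hc.continuousAt
  have h1 : x₀ ≤ ⨅ k, g^[k] z := le_ciInf hlow
  have h2 : ⨅ k, g^[k] z ≤ z := ciInf_le hbdd 0
  rcases h1.eq_or_lt with h3 | h3
  · rwa [← h3] at hlim
  · exact absurd hfix (h _ ⟨h3, h2.trans_lt hz.2⟩).ne

lemma tendsto_iterate_of_gt {g : ℝ → ℝ} (hg : Monotone g) (hc : Continuous g) {x₀ e : ℝ}
    (h0 : g x₀ = x₀) (h : ∀ z ∈ Ioo e x₀, z < g z) {z : ℝ} (hz : z ∈ Ioo e x₀) :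
    Tendsto (fun k => g^[k] z) atTop (𝓝 x₀) := by
  have hmono : Monotone fun k => g^[k] z :=
    hg.monotone_iterate_of_le_map (h z hz).le
  have hup : ∀ k, g^[k] z ≤ x₀ := fun k => by
    have := hg.iterate k hz.2.le
    rwa [Function.iterate_fixed h0] at this
  have hbdd : BddAbove (range fun k => g^[k] z) := ⟨x₀, by rintro _ ⟨k, rfl⟩; exact hup k⟩
  have hlim := tendsto_atTop_ciSup hmono hbdd
  have hfix := isFixedPt_of_tendsto_iterate hlim hc.continuousAt
  have h1 : ⨆ k, g^[k] z ≤ x₀ := ciSup_le hup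
  have h2 : z ≤ ⨆ k, g^[k] z := le_ciSup hbdd 0
  rcases h1.eq_or_lt with h3 | h3
  · rwa [h3] at hlim
  · exact absurd hfix (h _ ⟨hz.1.trans_le h2, h3⟩).ne'

variable {α b : ℝ}

lemma exists_right_slope (hb : b ∈ Ico (0 : ℝ) 1) (α : ℝ) (n : ℕ) (x : ℝ) :
    ∃ s > 0, ∀ᶠ z in 𝓝[>] x, (pdLift α b)^[n] z = (pdLift α b)^[n] x + s * (z - x) := by
  have key : ∀ x, ∃ s > 0, ∀ᶠ z in 𝓝[>] x, pdLift α b z = pdLift α b x + s * (z - x) := by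
    intro x
    have h1 := Int.floor_le x
    have h2 := Int.lt_floor_add_one x
    rcases lt_or_ge x (⌊x⌋ + 1 / 2) with h | h
    · refine ⟨2 + 2 * b, by linarith [hb.1], ?_⟩
      filter_upwards [Ioo_mem_nhdsGT h] with z hz
      rw [pdLift_of_mem_left (h1.trans hz.1.le) hz.2.le, pdLift_of_mem_left h1 h.le]
      ring
    · refine ⟨2 - 2 * b, by linarith [hb.2], ?_⟩
      filter_upwards [Ioo_mem_nhdsGT h2] with z hz
      rw [pdLift_of_mem_right (h.trans hz.1.le) hz.2.le, pdLift_of_mem_right h h2.le]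
      ring
  induction n with
  | zero => exact ⟨1, one_pos, by simp⟩
  | succ n ih =>
    obtain ⟨s, hs, h⟩ := ih
    obtain ⟨s', hs', h'⟩ := key ((pdLift α b)^[n] x)
    have ht : Tendsto (pdLift α b)^[n] (𝓝[>] x) (𝓝[>] ((pdLift α b)^[n] x)) :=
      tendsto_nhdsWithin_of_tendsto_nhds_of_eventually_within _
        ((continuous_iterate_pdLift α b n).continuousAt.tendsto.mono_left nhdsWithin_le_nhds)
        (eventually_mem_nhdsWithin.mono fun z hz => (pdLift_strictMono hb).iterate n hz)
    refine ⟨s' * s, by positivity, ?_⟩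
    filter_upwards [h, ht.eventually h'] with z hz hz'
    rw [Function.iterate_succ_apply', hz', hz, Function.iterate_succ_apply']
    ring

lemma exists_left_slope (hb : b ∈ Ico (0 : ℝ) 1) (α : ℝ) (n : ℕ) (x : ℝ) :
    ∃ s > 0, ∀ᶠ z in 𝓝[<] x, (pdLift α b)^[n] z = (pdLift α b)^[n] x + s * (z - x) := by
  have key : ∀ x, ∃ s > 0, ∀ᶠ z in 𝓝[<] x, pdLift α b z = pdLift α b x + s * (z - x) := by
    intro x
    obtain ⟨k, h1, h2⟩ : ∃ k : ℤ, (k : ℝ) < x ∧ x ≤ k + 1 :=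
      ⟨⌈x⌉ - 1, by push_cast; linarith [Int.ceil_lt_add_one x], by push_cast; linarith [Int.le_ceil x]⟩
    rcases le_or_gt x (k + 1 / 2) with h | h
    · refine ⟨2 + 2 * b, by linarith [hb.1], ?_⟩
      filter_upwards [Ioo_mem_nhdsLT h1] with z hz
      rw [pdLift_of_mem_left hz.1.le (hz.2.le.trans h), pdLift_of_mem_left h1.le h]
      ring
    · refine ⟨2 - 2 * b, by linarith [hb.2], ?_⟩
      filter_upwards [Ioo_mem_nhdsLT h] with z hz
      rw [pdLift_of_mem_right hz.1.le (hz.2.le.trans h2), pdLift_of_mem_right h.le h2]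
      ring
  induction n with
  | zero => exact ⟨1, one_pos, by simp⟩
  | succ n ih =>
    obtain ⟨s, hs, h⟩ := ih
    obtain ⟨s', hs', h'⟩ := key ((pdLift α b)^[n] x)
    have ht : Tendsto (pdLift α b)^[n] (𝓝[<] x) (𝓝[<] ((pdLift α b)^[n] x)) :=
      tendsto_nhdsWithin_of_tendsto_nhds_of_eventually_within _
        ((continuous_iterate_pdLift α b n).continuousAt.tendsto.mono_left nhdsWithin_le_nhds)
        (eventually_mem_nhdsWithin.mono fun z hz => (pdLift_strictMono hb).iterate n hz)
    refine ⟨s' * s, by positivity, ?_⟩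
    filter_upwards [h, ht.eventually h'] with z hz hz'
    rw [Function.iterate_succ_apply', hz', hz, Function.iterate_succ_apply']
    ring

lemma exists_attracting_fixed_germ (hb : b ∈ Ico (0 : ℝ) 1) {n : ℕ} {k : ℤ} {x y : ℝ}
    (hxy : x < y) (hx : x + k < (pdLift α b)^[n] x) (hy : (pdLift α b)^[n] y < y + k)
    (hrat : ∀ q : ℚ, (pdLift α b)^[n] q ≠ q + k) :
    ∃ x₀, (pdLift α b)^[n] x₀ = x₀ + k ∧ (∀ᶠ z in 𝓝[>] x₀, (pdLift α b)^[n] z < z + k) ∧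
      ∀ᶠ z in 𝓝[<] x₀, z + k < (pdLift α b)^[n] z := by
  set G := (pdLift α b)^[n]
  have hG : Continuous G := continuous_iterate_pdLift α b n
  set A := {z | z ∈ Icc x y ∧ z + k < G z} with hA
  have hne : A.Nonempty := ⟨x, left_mem_Icc.2 hxy.le, hx⟩
  have hbdd : BddAbove A := ⟨y, fun z hz => hz.1.2⟩
  have hlub := isLUB_csSup hne hbdd
  set x₀ := sSup A
  have hxx : x ≤ x₀ := hlub.1 ⟨left_mem_Icc.2 hxy.le, hx⟩
  have hyy : x₀ ≤ y := hlub.2 fun z hz => hz.1.2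
  have hge : x₀ + k ≤ G x₀ := by
    have hcl : IsClosed {z | z + k ≤ G z} := isClosed_le (by fun_prop) hG
    exact hcl.closure_subset_iff.2 (fun z hz => hz.2.le) (hlub.mem_closure hne)
  have hlt : x₀ < y := hyy.lt_of_ne fun h => by rw [h] at hge; linarith
  have hright : ∀ z, x₀ < z → z ≤ y → G z ≤ z + k := fun z h1 h2 => by
    by_contra! h
    exact (hlub.1 ⟨⟨hxx.trans h1.le, h2⟩, h⟩).not_gt h1
  have hfix : G x₀ = x₀ + k := by
    refine hge.antisymm' ?_
    refine le_of_tendsto_of_tendsto (hG.continuousAt.tendsto.mono_left nhdsWithin_le_nhds)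
      ((continuous_add_const (k : ℝ)).continuousAt.tendsto.mono_left nhdsWithin_le_nhds)
      (b := 𝓝[>] x₀) ?_
    filter_upwards [Ioo_mem_nhdsGT hlt] with z hz
    exact hright z hz.1 hz.2.le
  refine ⟨x₀, hfix, ?_, ?_⟩
  · obtain ⟨s, -, hs⟩ := exists_right_slope hb α n x₀
    have hs1 : s < 1 := by
      by_contra! hs1
      have h1 : ∀ᶠ z in 𝓝[>] x₀, G z = z + k := by
        filter_upwards [hs, Ioo_mem_nhdsGT hlt] with z hz hz'
        refine le_antisymm (hright z hz'.1 hz'.2.le) ?_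
        have : G z = G x₀ + s * (z - x₀) := hz
        rw [this, hfix]
        nlinarith [hz'.1]
      obtain ⟨e, he, h2⟩ := mem_nhdsGT_iff_exists_Ioo_subset.1 h1
      obtain ⟨q, hq1, hq2⟩ := exists_rat_btwn (mem_Ioi.1 he)
      exact hrat q (h2 ⟨hq1, hq2⟩)
    filter_upwards [hs, self_mem_nhdsWithin] with z hz hz'
    have : G z = G x₀ + s * (z - x₀) := hz
    rw [this, hfix]
    nlinarith [mem_Ioi.1 hz']
  · obtain ⟨s, -, hs⟩ := exists_left_slope hb α n x₀
    have hs1 : s < 1 := by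
      obtain ⟨e, he, h2⟩ := mem_nhdsLT_iff_exists_Ioo_subset.1 hs
      obtain ⟨z, hz, hz1, hz2⟩ := hlub.exists_between (mem_Iio.1 he)
      have hz3 : z ≠ x₀ := fun h => by rw [h] at hz; exact hz.2.ne' hfix
      have hz4 : z < x₀ := hz2.lt_of_ne hz3
      have h3 : G z = G x₀ + s * (z - x₀) := h2 ⟨hz1, hz4⟩
      have h4 := hz.2
      rw [h3, hfix] at h4
      nlinarith
    filter_upwards [hs, self_mem_nhdsWithin] with z hz hz'
    have : G z = G x₀ + s * (z - x₀) := hz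
    rw [this, hfix]
    nlinarith [mem_Iio.1 hz']

lemma exists_iterate_sub_eq (α b : ℝ) (N : ℕ) (k : ℤ) (j : ℕ) :
    ∃ K : ℤ, ∀ z, (fun w => (pdLift α b)^[N] w - k)^[j] z = (pdLift α b)^[N * j] z - K := by
  induction j with
  | zero => exact ⟨0, by simp⟩
  | succ j ih =>
    obtain ⟨K, hK⟩ := ih
    refine ⟨2 ^ N * K + k, fun z => ?_⟩
    rw [Function.iterate_succ_apply', hK, mul_add_one, add_comm (N * j), Function.iterate_add_apply]
    have := iterate_pdLift_add_int α b ((pdLift α b)^[N * j] z) (-K) N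
    push_cast at this ⊢
    rw [sub_eq_add_neg _ (K : ℝ), this]
    ring

lemma exists_isAttractingPeriodicPt (hb : b ∈ Icc (0 : ℝ) 1) {n : ℕ} (hn : 0 < n) {k : ℤ}
    {x₀ : ℝ} (hfix : (pdLift α b)^[n] x₀ = x₀ + k)
    (hright : ∀ᶠ z in 𝓝[>] x₀, (pdLift α b)^[n] z < z + k)
    (hleft : ∀ᶠ z in 𝓝[<] x₀, z + k < (pdLift α b)^[n] z) :
    ∃ m x, IsAttractingPeriodicPt (plpdm α b) m x := by
  have hper : Function.IsPeriodicPt (plpdm α b) n (x₀ : UnitAddCircle) := by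
    rw [Function.IsPeriodicPt, Function.IsFixedPt, iterate_plpdm_coe, hfix, coe_add_int]
  set N := Function.minimalPeriod (plpdm α b) (x₀ : UnitAddCircle) with hN
  have hN0 : 0 < N := hper.minimalPeriod_pos hn
  obtain ⟨q, hq⟩ : N ∣ n := hper.minimalPeriod_dvd
  have hNx : (plpdm α b)^[N] (x₀ : UnitAddCircle) = x₀ := Function.iterate_minimalPeriod
  obtain ⟨k', hk'⟩ := coe_eq_coe_iff_int.1 ((iterate_plpdm_coe α b x₀ N).symm.trans hNx)
  set g : ℝ → ℝ := fun w => (pdLift α b)^[N] w - k' with hg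
  have hgm : Monotone g := fun u v h => sub_le_sub_right ((pdLift_mono hb).iterate N h) _
  have hgc : Continuous g := (continuous_iterate_pdLift α b N).sub continuous_const
  have hg0 : g x₀ = x₀ := by simp [hg, hk']
  have hgq : ∀ z, g^[q] z = (pdLift α b)^[n] z - k := by
    obtain ⟨K, hK⟩ := exists_iterate_sub_eq α b N k' q
    have h1 := hK x₀
    rw [Function.iterate_fixed hg0, ← hq, hfix] at h1
    intro z
    rw [hK, ← hq]
    linarith
  have hgcoe : ∀ (j : ℕ) (z : ℝ), (plpdm α b)^[N * j] (z : UnitAddCircle) = (g^[j] z : ℝ) := fun j z => by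
    obtain ⟨K, hK⟩ := exists_iterate_sub_eq α b N k' j
    rw [hK, iterate_plpdm_coe, coe_eq_coe_iff_int]
    exact ⟨K, by ring⟩
  have hR : ∀ᶠ z in 𝓝[>] x₀, g z < z := hright.mono fun z hz => by
    by_contra! h
    have := hgm.monotone_iterate_of_le_map h (Nat.zero_le q)
    simp only [hgq, Function.iterate_zero, id] at this
    linarith
  have hL : ∀ᶠ z in 𝓝[<] x₀, z < g z := hleft.mono fun z hz => by
    by_contra! h
    have := hgm.antitone_iterate_of_map_le h (Nat.zero_le q)
    simp only [hgq, Function.iterate_zero, id] at this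
    linarith
  obtain ⟨e, he, he'⟩ := mem_nhdsGT_iff_exists_Ioo_subset.1 hR
  obtain ⟨d, hd, hd'⟩ := mem_nhdsLT_iff_exists_Ioo_subset.1 hL
  rw [mem_Ioi] at he
  rw [mem_Iio] at hd
  have hmap : ∀ z ∈ Ioo d e, g z ∈ Ioo d e := by
    intro z hz
    rcases lt_trichotomy z x₀ with h | rfl | h
    · have h1 : z < g z := hd' ⟨hz.1, h⟩
      have h2 : g z ≤ x₀ := hg0 ▸ hgm h.le
      exact ⟨hz.1.trans h1, h2.trans_lt he⟩
    · rw [hg0]; exact ⟨hd, he⟩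
    · have h1 : g z < z := he' ⟨h, hz.2⟩
      have h2 : x₀ ≤ g z := hg0 ▸ hgm h.le
      exact ⟨hd.trans_le h2, h1.trans hz.2⟩
  have hconv : ∀ z ∈ Ioo d e, Tendsto (fun j => g^[j] z) atTop (𝓝 x₀) := by
    intro z hz
    rcases lt_trichotomy z x₀ with h | rfl | h
    · exact tendsto_iterate_of_gt hgm hgc hg0 (fun w hw => hd' hw) ⟨hz.1, h⟩
    · simp only [Function.iterate_fixed hg0]
      exact tendsto_const_nhds
    · exact tendsto_iterate_of_lt hgm hgc hg0 (fun w hw => he' hw) ⟨h, hz.2⟩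
  refine ⟨N, x₀, hN0, hNx, fun m hm hmN => ?_, (fun t : ℝ => (t : UnitAddCircle)) '' Ioo d e,
    QuotientAddGroup.isOpenMap_coe _ isOpen_Ioo,
    (isConnected_Ioo (hd.trans he)).image _ (AddCircle.continuous_mk' 1).continuousOn,
    ⟨x₀, ⟨hd, he⟩, rfl⟩, ?_, ?_⟩
  · exact Function.not_isPeriodicPt_of_pos_of_lt_minimalPeriod hm.ne' hmN
  · rintro _ ⟨_, ⟨z, hz, rfl⟩, rfl⟩
    refine ⟨g z, hmap z hz, ?_⟩
    have := hgcoe 1 z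
    rw [mul_one] at this
    exact this.symm
  · rintro _ ⟨z, hz, rfl⟩
    simp only [hgcoe]
    exact ((AddCircle.continuous_mk' 1).tendsto x₀).comp (hconv z hz)

/-- Parameters for which some iterate of the lift, up to an integer translation, maps a
nondegenerate compact interval into its interior. -/
def trapSet : Set (ℝ × ℝ) :=
  {q | q.2 ∈ Icc (0 : ℝ) 1 ∧ ∃ (n : ℕ) (k : ℤ) (x y : ℝ), 0 < n ∧ x < y ∧
    x + k < (pdLift q.1 q.2)^[n] x ∧ (pdLift q.1 q.2)^[n] y < y + k}

lemma continuous_iterate_pdLift_param (n : ℕ) (x : ℝ) :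
    Continuous fun q : ℝ × ℝ => (pdLift q.1 q.2)^[n] x :=
  (continuous_iterate_pdLift_prod n).comp (by fun_prop : Continuous fun q : ℝ × ℝ => (q, x))

lemma mem_closure_hypSet_of_mem_trapSet {q : ℝ × ℝ} (hq : q ∈ trapSet) :
    ((q.1 : UnitAddCircle), q.2) ∈ closure hypSet := by
  obtain ⟨α, b⟩ := q
  obtain ⟨hb, n, k, x, y, hn, hxy, hx, hy⟩ := hq
  simp only at hb hx hy ⊢
  rw [mem_closure_iff_nhds]
  intro W hW
  have hcoe : Continuous fun q : ℝ × ℝ => ((q.1 : UnitAddCircle), q.2) :=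
    ((AddCircle.continuous_mk' 1).comp continuous_fst).prodMk continuous_snd
  have h1 : ∀ᶠ q : ℝ × ℝ in 𝓝 (α, b), ((q.1 : UnitAddCircle), q.2) ∈ W :=
    hcoe.continuousAt.eventually_mem hW
  have h2 : ∀ᶠ q : ℝ × ℝ in 𝓝 (α, b), x + k < (pdLift q.1 q.2)^[n] x :=
    (continuous_iterate_pdLift_param n x).continuousAt.eventually_const_lt hx
  have h3 : ∀ᶠ q : ℝ × ℝ in 𝓝 (α, b), (pdLift q.1 q.2)^[n] y < y + k :=
    (continuous_iterate_pdLift_param n y).continuousAt.eventually_lt_const hy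
  obtain ⟨ε, hε, h⟩ := Metric.eventually_nhds_iff_ball.1 (h1.and (h2.and h3))
  obtain ⟨b', hb', hbb⟩ : ∃ b' ∈ Ico (0 : ℝ) 1, dist b' b < ε := by
    rcases le_or_gt (b - ε / 2) 0 with h0 | h0
    · exact ⟨0, by simp, by rw [Real.dist_eq, zero_sub, abs_neg, abs_of_nonneg hb.1]; linarith⟩
    · refine ⟨b - ε / 2, ⟨h0.le, by linarith [hb.2]⟩, ?_⟩
      rw [Real.dist_eq, sub_sub_cancel_left, abs_neg, abs_of_pos (by linarith)]
      linarith
  have hcount : (⋃ q : ℚ, {t : ℝ | (pdLift t b')^[n] q = q + k}).Countable := by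
    refine countable_iUnion fun q => Set.Subsingleton.countable fun s hs t ht => ?_
    rw [mem_ofPred_eq] at hs ht
    rcases le_total s t with hst | hst
    · have := iterate_pdLift_add_le (α := s) ⟨hb'.1, hb'.2.le⟩ (sub_nonneg.2 hst) hn q
      rw [add_sub_cancel] at this
      linarith
    · have := iterate_pdLift_add_le (α := t) ⟨hb'.1, hb'.2.le⟩ (sub_nonneg.2 hst) hn q
      rw [add_sub_cancel] at this
      linarith
  obtain ⟨α', hα', hαα⟩ := (hcount.dense_compl ℝ).exists_dist_lt α hε
  simp only [mem_compl_iff, mem_iUnion, mem_ofPred_eq, not_exists] at hα'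
  obtain ⟨hW', hx', hy'⟩ := h (α', b') (by
    rw [Metric.mem_ball, Prod.dist_eq]
    exact max_lt (by rwa [dist_comm]) hbb)
  obtain ⟨x₀, hfix, hr, hl⟩ := exists_attracting_fixed_germ hb' hxy hx' hy' hα'
  exact ⟨_, hW', hb', exists_isAttractingPeriodicPt ⟨hb'.1, hb'.2.le⟩ hn hfix hr hl⟩

lemma mem_closure_hypSet {q : ℝ × ℝ} (hq : q ∈ closure trapSet) :
    ((q.1 : UnitAddCircle), q.2) ∈ closure hypSet := by
  have hcoe : Continuous fun q : ℝ × ℝ => ((q.1 : UnitAddCircle), q.2) :=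
    ((AddCircle.continuous_mk' 1).comp continuous_fst).prodMk continuous_snd
  exact closure_minimal (fun q hq => mem_closure_hypSet_of_mem_trapSet hq)
    (isClosed_closure.preimage hcoe) hq

end Attraction

section Perturbation

variable {α b : ℝ}

lemma mem_closure_trapSet_of_le (hb : b ∈ Icc (0 : ℝ) 1) {n : ℕ} (hn : 0 < n) {k : ℤ} {x y : ℝ}
    (hxy : x < y) (hx : x + k ≤ (pdLift α b)^[n] x) (hy : (pdLift α b)^[n] y ≤ y + k)
    (h : x + k < (pdLift α b)^[n] x ∨ (pdLift α b)^[n] y < y + k) :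
    (α, b) ∈ closure trapSet := by
  have hlim : Tendsto (fun t : ℝ => (α + t, b)) (𝓝 0) (𝓝 (α, b)) := by
    have : Continuous fun t : ℝ => (α + t, b) := by fun_prop
    simpa using this.tendsto 0
  rcases h with h | h
  · refine mem_closure_of_tendsto (hlim.mono_left nhdsWithin_le_nhds) (b := 𝓝[<] 0) ?_
    have h1 := (hlim.eventually ((continuous_iterate_pdLift_param n x).continuousAt.eventually_const_lt
      h)).filter_mono (nhdsWithin_le_nhds (s := Iio 0))
    filter_upwards [h1, self_mem_nhdsWithin] with t ht ht'
    rw [mem_Iio] at ht'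
    have h2 := iterate_pdLift_add_le (α := α + t) hb (neg_nonneg.2 ht'.le) hn y
    rw [add_neg_cancel_right] at h2
    exact ⟨hb, n, k, x, y, hn, hxy, ht, by simp only; linarith⟩
  · refine mem_closure_of_tendsto (hlim.mono_left nhdsWithin_le_nhds) (b := 𝓝[>] 0) ?_
    have h1 := (hlim.eventually ((continuous_iterate_pdLift_param n y).continuousAt.eventually_lt_const
      h)).filter_mono (nhdsWithin_le_nhds (s := Ioi 0))
    filter_upwards [h1, self_mem_nhdsWithin] with t ht ht'
    rw [mem_Ioi] at ht'
    have h2 := iterate_pdLift_add_le (α := α) hb ht'.le hn x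
    exact ⟨hb, n, k, x, y, hn, hxy, by simp only; linarith, ht⟩

lemma continuous_iterate_pdLift_add (α b : ℝ) (n : ℕ) (x : ℝ) :
    Continuous fun t : ℝ => (pdLift (α + t) b)^[n] x :=
  (continuous_iterate_pdLift_param n x).comp (by fun_prop : Continuous fun t : ℝ => (α + t, b))

lemma exists_iterate_half_mem_flat (α : ℝ) {τ : ℝ} (hτ : 0 < τ) :
    ∃ s ∈ Icc 0 τ, ∃ n : ℕ, 0 < n ∧ ∃ k : ℤ,
      (pdLift (α + s) 1)^[n] (1 / 2) ∈ Icc (1 / 2 + k : ℝ) (1 + k) := by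
  by_contra! H
  have hb : (1 : ℝ) ∈ Icc (0 : ℝ) 1 := by simp
  set h : ℕ → ℝ → ℝ := fun n s => (pdLift (α + s) 1)^[n] (1 / 2) with hh
  have hloc : ∀ n, 0 < n → ∃ k : ℤ, k ≤ h n 0 ∧ h n 0 ≤ h n τ ∧ h n τ < k + 1 / 2 := by
    intro n hn
    have h0 := Int.floor_le (h n 0)
    have h1 := Int.lt_floor_add_one (h n 0)
    have h2 : h n 0 < ⌊h n 0⌋ + 1 / 2 := by
      by_contra! h3
      exact H 0 ⟨le_rfl, hτ.le⟩ n hn ⌊h n 0⌋ ⟨by linarith, by linarith⟩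
    refine ⟨⌊h n 0⌋, h0, ?_, ?_⟩
    · simpa [hh] using iterate_pdLift_le (α := α) hb hτ.le n (1 / 2)
    · by_contra! h3
      obtain ⟨s, hs, hs'⟩ := intermediate_value_Icc hτ.le
        (continuous_iterate_pdLift_add α 1 n (1 / 2)).continuousOn ⟨h2.le, h3⟩
      beta_reduce at hs'
      exact H s hs n hn ⌊h n 0⌋ (by rw [hs']; constructor <;> linarith)
  have hgrow : ∀ n, 4 ^ n * τ ≤ h (n + 1) τ - h (n + 1) 0 := by
    intro n
    induction n with
    | zero => simp [hh, pdLift]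
    | succ n ih =>
      obtain ⟨k, h1, h2, h3⟩ := hloc (n + 1) n.succ_pos
      simp only [hh] at h1 h2 h3 ih ⊢
      rw [Function.iterate_succ_apply' _ (n + 1), Function.iterate_succ_apply' _ (n + 1),
        pdLift_of_mem_left (h1.trans h2) h3.le, pdLift_of_mem_left h1 (h2.trans h3.le), pow_succ]
      linarith
  obtain ⟨n, hn⟩ := pow_unbounded_of_one_lt (1 / τ) (by norm_num : (1 : ℝ) < 4)
  rw [div_lt_iff₀ hτ] at hn
  obtain ⟨k, h1, h2, h3⟩ := hloc (n + 1) n.succ_pos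
  linarith [hgrow n]

lemma mem_closure_trapSet_one (α : ℝ) : (α, (1 : ℝ)) ∈ closure trapSet := by
  rw [← closure_closure, Metric.mem_closure_iff]
  intro ε hε
  obtain ⟨s, hs, n, hn, k, hk⟩ := exists_iterate_half_mem_flat α (half_pos hε)
  refine ⟨(α + s, 1), ?_, ?_⟩
  · have h1 : (pdLift (α + s) 1)^[n] 1 = (pdLift (α + s) 1)^[n] (1 / 2) := by
      obtain ⟨m, rfl⟩ := Nat.exists_eq_succ_of_ne_zero hn.ne'
      rw [Function.iterate_succ_apply, Function.iterate_succ_apply,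
        pdLift_of_mem_right (k := 0) (z := 1) (by norm_num) (by norm_num),
        pdLift_of_mem_right (k := 0) (z := 1 / 2) (by norm_num) (by norm_num)]
      norm_num
    refine mem_closure_trapSet_of_le (by simp) hn (x := 1 / 2) (y := 1) (k := k) (by norm_num)
      hk.1 (h1 ▸ hk.2) ?_
    rw [h1]
    by_contra! h
    linarith [h.1, h.2]
  · rw [Prod.dist_eq, dist_self, Real.dist_eq, sub_add_cancel_left, abs_neg, abs_of_nonneg hs.1]
    exact max_lt (by linarith [hs.2]) hε

/-- The slope of the `n`-th iterate along an orbit whose signs of slope are given by `σ`. -/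
noncomputable def slopeProd (σ : ℕ → ℝ) (b : ℝ) (n : ℕ) : ℝ :=
  ∏ i ∈ Finset.range n, (2 + 2 * b * σ i)

lemma exists_locally_affine (α b z : ℝ)
    (hz : ∀ (j : ℕ) (i : ℤ), (pdLift α b)^[j] z ≠ i / 2) :
    ∃ σ : ℕ → ℝ, (∀ i, σ i = 1 ∨ σ i = -1) ∧ ∀ n, ∀ᶠ q : (ℝ × ℝ) × ℝ in 𝓝 ((α, b), z),
      (pdLift q.1.1 q.1.2)^[n] q.2 - (pdLift q.1.1 q.1.2)^[n] z =
        slopeProd σ q.1.2 n * (q.2 - z) := by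
  have key : ∀ j, ∃ s : ℝ, (s = 1 ∨ s = -1) ∧ ∃ u v : ℝ, (pdLift α b)^[j] z ∈ Ioo u v ∧
      ∀ α' b', ∀ w ∈ Ioo u v, ∀ w' ∈ Ioo u v,
        pdLift α' b' w - pdLift α' b' w' = (2 + 2 * b' * s) * (w - w') := by
    intro j
    set p := (pdLift α b)^[j] z
    have h1 : (⌊p⌋ : ℝ) < p := (Int.floor_le p).lt_of_ne fun h => hz j (2 * ⌊p⌋) (by
      push_cast; change p = _; linarith)
    have h2 := Int.lt_floor_add_one p
    have h3 : p ≠ ⌊p⌋ + 1 / 2 := fun h => hz j (2 * ⌊p⌋ + 1) (by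
      push_cast; change p = _; linarith)
    rcases h3.lt_or_gt with h | h
    · refine ⟨1, Or.inl rfl, ⌊p⌋, ⌊p⌋ + 1 / 2, ⟨h1, h⟩, fun α' b' w hw w' hw' => ?_⟩
      rw [pdLift_of_mem_left hw.1.le hw.2.le, pdLift_of_mem_left hw'.1.le hw'.2.le]
      ring
    · refine ⟨-1, Or.inr rfl, ⌊p⌋ + 1 / 2, ⌊p⌋ + 1, ⟨h, h2⟩, fun α' b' w hw w' hw' => ?_⟩
      rw [pdLift_of_mem_right hw.1.le hw.2.le, pdLift_of_mem_right hw'.1.le hw'.2.le]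
      ring
  choose σ hσ u v hmem hσ' using key
  refine ⟨σ, hσ, fun n => ?_⟩
  induction n with
  | zero => simp [slopeProd]
  | succ n ih =>
    have hnhds := isOpen_Ioo.mem_nhds (hmem n)
    have h1 := ((continuous_iterate_pdLift_prod n).continuousAt (x := ((α, b), z))).eventually_mem hnhds
    have h2 := (((continuous_iterate_pdLift_param n z).comp continuous_fst).continuousAt
      (x := ((α, b), z))).eventually_mem hnhds
    filter_upwards [ih, h1, h2] with q hq hq1 hq2
    simp only [Function.comp_apply] at hq2
    rw [Function.iterate_succ_apply', Function.iterate_succ_apply', hσ' n _ _ _ hq1 _ hq2, hq,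
      slopeProd, slopeProd, Finset.prod_range_succ]
    ring

lemma slopeProd_pos {σ : ℕ → ℝ} (hσ : ∀ i, σ i = 1 ∨ σ i = -1) (hb : b ∈ Ico (0 : ℝ) 1) (n : ℕ) :
    0 < slopeProd σ b n :=
  Finset.prod_pos fun i _ => by rcases hσ i with h | h <;> rw [h] <;> linarith [hb.1, hb.2]

lemma exists_slopeProd_lt_one {σ : ℕ → ℝ} (hσ : ∀ i, σ i = 1 ∨ σ i = -1)
    (hb : b ∈ Ioo (0 : ℝ) 1) {n : ℕ} (hn : 0 < n) (h1 : slopeProd σ b n = 1) {ε : ℝ} (hε : 0 < ε) :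
    ∃ b' ∈ Ico (0 : ℝ) 1, |b' - b| < ε ∧ slopeProd σ b' n < 1 := by
  obtain ⟨h, hh0, hh⟩ := exists_between (lt_min hε (lt_min hb.1 (sub_pos.2 hb.2)))
  obtain ⟨hhε, hh⟩ := lt_min_iff.1 hh
  obtain ⟨hhb, hhb'⟩ := lt_min_iff.1 hh
  have hm1 : b + h ∈ Ico (0 : ℝ) 1 := ⟨by linarith, by linarith⟩
  have hm2 : b - h ∈ Ico (0 : ℝ) 1 := ⟨by linarith, by linarith [hb.2]⟩
  have hprod : slopeProd σ (b + h) n * slopeProd σ (b - h) n < slopeProd σ b n * slopeProd σ b n := by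
    unfold slopeProd
    rw [← Finset.prod_mul_distrib, ← Finset.prod_mul_distrib]
    have hlt : ∀ i, (2 + 2 * (b + h) * σ i) * (2 + 2 * (b - h) * σ i) <
        (2 + 2 * b * σ i) * (2 + 2 * b * σ i) := fun i => by
      rcases hσ i with h | h <;> rw [h] <;> nlinarith
    refine Finset.prod_lt_prod (fun i _ => ?_) (fun i _ => (hlt i).le)
      ⟨0, Finset.mem_range.2 hn, hlt 0⟩
    rcases hσ i with h | h <;> rw [h] <;> nlinarith [hm1.1, hm1.2, hm2.1, hm2.2]
  rw [h1, one_mul] at hprod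
  by_cases h2 : slopeProd σ (b + h) n < 1
  · exact ⟨b + h, hm1, by rwa [add_sub_cancel_left, abs_of_pos hh0], h2⟩
  · refine ⟨b - h, hm2, by rwa [sub_sub_cancel_left, abs_neg, abs_of_pos hh0], ?_⟩
    push Not at h2
    nlinarith [slopeProd_pos hσ hm2 n]

lemma exists_forall_iterate_ne (hb : b ∈ Ico (0 : ℝ) 1) (α : ℝ) {u v : ℝ} (huv : u < v) :
    ∃ z ∈ Ioo u v, ∀ (j : ℕ) (i : ℤ), (pdLift α b)^[j] z ≠ i / 2 := by
  have hcount : (⋃ (j : ℕ) (i : ℤ), {z : ℝ | (pdLift α b)^[j] z = i / 2}).Countable :=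
    countable_iUnion fun j => countable_iUnion fun i => Set.Subsingleton.countable fun s hs t ht =>
      ((pdLift_strictMono hb).iterate j).injective (hs.trans ht.symm)
  obtain ⟨z, hz, hz'⟩ := (hcount.dense_compl ℝ).exists_between huv
  simp only [mem_compl_iff, mem_iUnion, mem_ofPred_eq, not_exists] at hz
  exact ⟨z, hz', hz⟩

lemma mem_closure_trapSet_of_iterate_eq (hb : b ∈ Ico (0 : ℝ) 1) {n : ℕ} (hn : 0 < n) {k : ℤ}
    {u v : ℝ} (huv : u < v) (hid : ∀ z ∈ Icc u v, (pdLift α b)^[n] z = z + k) :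
    (α, b) ∈ closure trapSet := by
  have hb' : b ∈ Icc (0 : ℝ) 1 := ⟨hb.1, hb.2.le⟩
  obtain ⟨z, hz, hzne⟩ := exists_forall_iterate_ne hb α huv
  obtain ⟨σ, hσ, haff⟩ := exists_locally_affine α b z hzne
  obtain ⟨ε, hε, hball⟩ := Metric.eventually_nhds_iff_ball.1 (haff n)
  have hball' : ∀ α' b' w, |α' - α| < ε → |b' - b| < ε → |w - z| < ε →
      (pdLift α' b')^[n] w - (pdLift α' b')^[n] z = slopeProd σ b' n * (w - z) :=
    fun α' b' w h1 h2 h3 => hball ((α', b'), w) (by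
      rw [Metric.mem_ball, Prod.dist_eq, Prod.dist_eq]
      exact max_lt (max_lt h1 h2) h3)
  have hslope : slopeProd σ b n = 1 := by
    obtain ⟨w, hw1, hw2⟩ := exists_between (lt_min hz.2 (lt_add_of_pos_right z hε))
    obtain ⟨hw2, hw3⟩ := lt_min_iff.1 hw2
    have h := hball' α b w (by simpa) (by simpa) (by rw [abs_of_pos] <;> linarith)
    rw [hid z ⟨hz.1.le, hz.2.le⟩, hid w ⟨by linarith [hz.1], hw2.le⟩] at h
    have h0 : w - z ≠ 0 := by linarith
    field_simp at h
    refine mul_right_cancel₀ h0 ?_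
    linarith
  have hb0 : b ∈ Ioo (0 : ℝ) 1 := by
    refine ⟨hb.1.lt_of_ne fun h => ?_, hb.2⟩
    rw [← h] at hslope
    simp only [slopeProd, mul_zero, zero_mul, add_zero, Finset.prod_const, Finset.card_range] at hslope
    exact (one_lt_pow₀ (by norm_num : (1 : ℝ) < 2) hn.ne').ne' hslope
  have hzk := hid z ⟨hz.1.le, hz.2.le⟩
  rw [← closure_closure, Metric.mem_closure_iff]
  intro δ hδ
  obtain ⟨τ, hτ0, hτ⟩ := exists_between (lt_min hε hδ)
  obtain ⟨hτε, hτδ⟩ := lt_min_iff.1 hτ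
  have hup : z + k < (pdLift (α + τ) b)^[n] z := by
    linarith [iterate_pdLift_add_le (α := α) hb' hτ0.le hn z]
  have hdown : (pdLift (α + -τ) b)^[n] z < z + k := by
    have := iterate_pdLift_add_le (α := α + -τ) hb' hτ0.le hn z
    rw [neg_add_cancel_right] at this
    linarith
  have hcont : ∀ t : ℝ, Continuous fun b' : ℝ => (pdLift t b')^[n] z := fun t =>
    (continuous_iterate_pdLift_param n z).comp (by fun_prop : Continuous fun b' : ℝ => (t, b'))
  obtain ⟨η, hη, hηball⟩ := Metric.eventually_nhds_iff_ball.1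
    (((hcont (α + τ)).continuousAt.eventually_const_lt hup).and
      ((hcont (α + -τ)).continuousAt.eventually_lt_const hdown))
  obtain ⟨b', hbm, hbb, hs⟩ := exists_slopeProd_lt_one hσ hb0 hn hslope
    (lt_min hη (lt_min hε hδ))
  obtain ⟨hbη, hbb⟩ := lt_min_iff.1 hbb
  obtain ⟨hbε, hbδ⟩ := lt_min_iff.1 hbb
  obtain ⟨h1, h2⟩ := hηball b' hbη
  obtain ⟨t, ht, htz⟩ := intermediate_value_Icc (by linarith : -τ ≤ τ)
    (continuous_iterate_pdLift_add α b' n z).continuousOn ⟨h2.le, h1.le⟩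
  have htabs : |α + t - α| ≤ τ := by
    rw [add_sub_cancel_left]
    exact abs_le.2 ht
  have hε2 : |z + ε / 2 - z| < ε := by
    rw [add_sub_cancel_left, abs_of_pos] <;> linarith
  have haffine := hball' (α + t) b' (z + ε / 2) (by linarith) hbε hε2
  refine ⟨(α + t, b'), ?_, ?_⟩
  · have hlt : (pdLift (α + t) b')^[n] (z + ε / 2) < z + ε / 2 + k := by
      simp only at htz
      rw [htz] at haffine
      nlinarith
    exact mem_closure_trapSet_of_le ⟨hbm.1, hbm.2.le⟩ hn (by linarith : z < z + ε / 2) htz.ge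
      hlt.le (Or.inr hlt)
  · rw [dist_comm, Prod.dist_eq]
    exact max_lt (by rw [Real.dist_eq]; linarith) hbδ

lemma mem_closure_trapSet_of_periodic (hb : b ∈ Ico (0 : ℝ) 1) {x y : ℝ} (hxy : x < y)
    (hP : pdPhi α b x = pdPhi α b y) {m n : ℕ} (hmn : m < n) {k : ℤ}
    (hk : 2 ^ n * pdPhi α b x = 2 ^ m * pdPhi α b x + k) :
    (α, b) ∈ closure trapSet := by
  have hb' : b ∈ Icc (0 : ℝ) 1 := ⟨hb.1, hb.2.le⟩
  obtain ⟨p, rfl⟩ := Nat.exists_eq_add_of_lt hmn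
  set θ := 2 ^ m * pdPhi α b x with hθ
  set P := {z | pdPhi α b z = θ} with hPdef
  have hcl : IsClosed P := isClosed_eq (continuous_pdPhi α b) continuous_const
  have hsub : P ⊆ Icc (θ - (|α| + |b|)) (θ + (|α| + |b|)) := fun z hz => by
    have h := abs_le.1 (abs_pdPhi_sub_le α b z)
    rw [show pdPhi α b z = θ from hz] at h
    exact ⟨by linarith, by linarith⟩
  have hcomp : IsCompact P := isCompact_Icc.of_isClosed_subset hcl hsub
  have hx : (pdLift α b)^[m] x ∈ P := pdPhi_iterate α b x m
  have hy : (pdLift α b)^[m] y ∈ P := by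
    rw [hPdef, mem_ofPred_eq, pdPhi_iterate, ← hP]
  obtain ⟨u, hu, hu'⟩ := hcomp.exists_isLeast ⟨_, hx⟩
  obtain ⟨v, hv, hv'⟩ := hcomp.exists_isGreatest ⟨_, hx⟩
  have huv : u < v :=
    (hu' hx).trans_lt (((pdLift_strictMono hb).iterate m hxy).trans_le (hv' hy))
  have hmap : ∀ z ∈ P, (pdLift α b)^[p + 1] z - k ∈ P := fun z hz => by
    have h := pdPhi_add_int α b ((pdLift α b)^[p + 1] z) (-k)
    push_cast at h
    rw [hPdef, mem_ofPred_eq, sub_eq_add_neg, h, pdPhi_iterate, show pdPhi α b z = θ from hz]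
    have : (2 : ℝ) ^ (m + p + 1) * pdPhi α b x = 2 ^ (p + 1) * θ := by rw [hθ]; ring
    linarith
  have hu2 : u + k ≤ (pdLift α b)^[p + 1] u := by linarith [hu' (hmap u hu)]
  have hv2 : (pdLift α b)^[p + 1] v ≤ v + k := by linarith [hv' (hmap v hv)]
  by_cases hid : ∀ z ∈ Icc u v, (pdLift α b)^[p + 1] z = z + k
  · exact mem_closure_trapSet_of_iterate_eq hb p.succ_pos huv hid
  · push Not at hid
    obtain ⟨z, hz, hne⟩ := hid
    rcases hne.lt_or_gt with h | h
    · have huz : u < z := hz.1.lt_of_ne fun h' => by rw [← h'] at h; linarith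
      exact mem_closure_trapSet_of_le hb' p.succ_pos huz hu2 h.le (Or.inr h)
    · have hzv : z < v := hz.2.lt_of_ne fun h' => by rw [h'] at h; linarith
      exact mem_closure_trapSet_of_le hb' p.succ_pos hzv h.le hv2 (Or.inl h)

end Perturbation

section Wandering

variable {α b x y : ℝ}

/-- The last point of `ℤ + 1/2` that is not to the right of the `n`-th iterate of `x`. -/
noncomputable def lastHalf (α b x : ℝ) (n : ℕ) : ℝ :=
  round ((pdLift α b)^[n] x) - 1 / 2

/-- The length of the `n`-th iterate of the interval `[x, y]`. -/
noncomputable def gapLength (α b x y : ℝ) (n : ℕ) : ℝ :=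
  (pdLift α b)^[n] y - (pdLift α b)^[n] x

lemma lastHalf_le (α b x : ℝ) (n : ℕ) : lastHalf α b x n ≤ (pdLift α b)^[n] x := by
  have h := Int.floor_le ((pdLift α b)^[n] x + 1 / 2)
  rw [← round_eq] at h
  unfold lastHalf
  linarith

lemma lt_lastHalf_add_one (α b x : ℝ) (n : ℕ) :
    (pdLift α b)^[n] x < lastHalf α b x n + 1 := by
  have h := Int.lt_floor_add_one ((pdLift α b)^[n] x + 1 / 2)
  rw [← round_eq] at h
  unfold lastHalf
  linarith

lemma pdPhi_lastHalf (α b x : ℝ) (n : ℕ) :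
    pdPhi α b (lastHalf α b x n) =
      pdPhi α b (1 / 2) + ((round ((pdLift α b)^[n] x) - 1 : ℤ) : ℝ) := by
  rw [← pdPhi_add_int]
  congr 1
  unfold lastHalf
  push_cast
  ring

lemma pdPhi_lastHalf_add_one (α b x : ℝ) (n : ℕ) :
    pdPhi α b (lastHalf α b x n + 1) = pdPhi α b (lastHalf α b x n) + 1 := by
  simpa using pdPhi_add_int α b (lastHalf α b x n) 1

lemma pdPhi_lastHalf_lt (hb : b ∈ Icc (0 : ℝ) 1)
    (hgen : ∀ (n : ℕ) (k : ℤ), 2 ^ n * pdPhi α b x ≠ pdPhi α b (1 / 2) + k) (n : ℕ) :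
    pdPhi α b (lastHalf α b x n) < pdPhi α b ((pdLift α b)^[n] x) := by
  refine (pdPhi_mono (α := α) hb (lastHalf_le α b x n)).lt_of_ne fun h => ?_
  rw [pdPhi_lastHalf, pdPhi_iterate] at h
  exact hgen _ _ h.symm

lemma iterate_lt_lastHalf_add_one (hb : b ∈ Icc (0 : ℝ) 1) (hP : pdPhi α b x = pdPhi α b y)
    (hgen : ∀ (n : ℕ) (k : ℤ), 2 ^ n * pdPhi α b x ≠ pdPhi α b (1 / 2) + k) (n : ℕ) :
    (pdLift α b)^[n] y < lastHalf α b x n + 1 := by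
  by_contra! h
  have h1 := pdPhi_mono (α := α) hb h
  have h2 := pdPhi_mono (α := α) hb (lt_lastHalf_add_one α b x n).le
  rw [pdPhi_iterate, ← hP] at h1
  rw [pdPhi_iterate] at h2
  have h3 := h1.antisymm h2
  rw [pdPhi_lastHalf_add_one, pdPhi_lastHalf] at h3
  refine hgen n (round ((pdLift α b)^[n] x) - 1 + 1) ?_
  rw [← h3]
  push_cast
  ring

lemma gapLength_pos (hb : b ∈ Ico (0 : ℝ) 1) (hxy : x < y) (n : ℕ) : 0 < gapLength α b x y n :=
  sub_pos.2 ((pdLift_strictMono hb).iterate n hxy)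

lemma tendsto_gapLength (hb : b ∈ Ico (0 : ℝ) 1) (hxy : x < y) (hP : pdPhi α b x = pdPhi α b y)
    (hwan : ∀ (m n : ℕ) (k : ℤ), m < n → 2 ^ n * pdPhi α b x ≠ 2 ^ m * pdPhi α b x + k) :
    Tendsto (gapLength α b x y) atTop (𝓝 0) := by
  have hb' : b ∈ Icc (0 : ℝ) 1 := ⟨hb.1, hb.2.le⟩
  have hfin : ∀ η > 0, {n | η ≤ gapLength α b x y n}.Finite := by
    intro η hη
    by_contra hinf
    obtain ⟨m, hm, n, hn, hmn, hfl⟩ := Set.Infinite.exists_ne_map_eq_of_mapsTo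
      (f := fun n => ⌊Int.fract ((pdLift α b)^[n] x) / η⌋) (t := Icc 0 ⌊1 / η⌋) hinf
      (fun n _ => ⟨Int.floor_nonneg.2 (by have := Int.fract_nonneg ((pdLift α b)^[n] x); positivity),
        Int.floor_le_floor (by gcongr; exact (Int.fract_lt_one _).le)⟩) (finite_Icc _ _)
    have key : ∀ m n, η ≤ gapLength α b x y m →
        ⌊Int.fract ((pdLift α b)^[m] x) / η⌋ = ⌊Int.fract ((pdLift α b)^[n] x) / η⌋ →
        Int.fract ((pdLift α b)^[m] x) ≤ Int.fract ((pdLift α b)^[n] x) →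
        ∃ k : ℤ, 2 ^ n * pdPhi α b x = 2 ^ m * pdPhi α b x + k := by
      intro m n hm h hle
      have h1 := Int.abs_sub_lt_one_of_floor_eq_floor h
      rw [← sub_div, abs_div, abs_of_pos hη, div_lt_one hη] at h1
      have h1 := (abs_lt.1 h1).1
      unfold gapLength at hm
      unfold Int.fract at h1 hle
      set p := (pdLift α b)^[m] x
      set q := (pdLift α b)^[n] x with hq
      have h2 : p ≤ q + ((⌊p⌋ - ⌊q⌋ : ℤ) : ℝ) := by push_cast; linarith
      have h3 : q + ((⌊p⌋ - ⌊q⌋ : ℤ) : ℝ) ≤ (pdLift α b)^[m] y := by push_cast; linarith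
      have h4 := pdPhi_mono (α := α) hb' h2
      have h5 := pdPhi_mono (α := α) hb' h3
      rw [pdPhi_add_int, pdPhi_iterate] at h4 h5
      rw [pdPhi_iterate] at h4
      rw [pdPhi_iterate, ← hP] at h5
      refine ⟨-(⌊p⌋ - ⌊q⌋), ?_⟩
      rw [Int.cast_neg]
      linarith
    have hne : ∀ (m n : ℕ) (k : ℤ), m ≠ n → 2 ^ n * pdPhi α b x ≠ 2 ^ m * pdPhi α b x + k := by
      intro m n k hmn h
      rcases hmn.lt_or_gt with h' | h'
      · exact hwan m n k h' h
      · refine hwan n m (-k) h' ?_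
        rw [Int.cast_neg]
        linarith
    rcases le_total (Int.fract ((pdLift α b)^[m] x)) (Int.fract ((pdLift α b)^[n] x)) with hle | hle
    · obtain ⟨k, hk⟩ := key m n hm hfl hle
      exact hne m n k hmn hk
    · obtain ⟨k, hk⟩ := key n m hn hfl.symm hle
      exact hne n m k hmn.symm hk
  refine Metric.tendsto_nhds.2 fun η hη => ?_
  rw [← Nat.cofinite_eq_atTop]
  filter_upwards [(hfin η hη).compl_mem_cofinite] with n hn
  rw [Real.dist_eq, sub_zero, abs_of_pos (gapLength_pos hb hxy n)]
  simpa using hn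

lemma iterate_sub_mul_gapLength_le (hb : b ∈ Ico (0 : ℝ) 1) (hxy : x < y)
    (hr : ∀ n, (pdLift α b)^[n] y < lastHalf α b x n + 1) {t w w' : ℝ} (hw : w ≤ w') {i m : ℕ}
    (h : ∀ j < m, lastHalf α b x (i + j) ≤ (pdLift (α + t) b)^[j] w ∧
      (pdLift (α + t) b)^[j] w' ≤ (pdLift α b)^[i + j] x) :
    ((pdLift (α + t) b)^[m] w' - (pdLift (α + t) b)^[m] w) * gapLength α b x y i ≤
      gapLength α b x y (i + m) * (w' - w) := by
  induction m with
  | zero => simp [mul_comm]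
  | succ m ih =>
    have ih := ih fun j hj => h j (hj.trans m.lt_succ_self)
    obtain ⟨h1, h2⟩ := h m m.lt_succ_self
    have hmono := ((pdLift_strictMono (α := α + t) hb).iterate m).monotone hw
    have hg := gapLength_pos (α := α) hb hxy (i + m)
    have hr' := (hr (i + m)).le
    have hs : gapLength α b x y (i + (m + 1)) =
        pdLift α b ((pdLift α b)^[i + m] y) - pdLift α b ((pdLift α b)^[i + m] x) := by
      rw [← add_assoc, gapLength, Function.iterate_succ_apply', Function.iterate_succ_apply']
    have hshift : ∀ z, pdLift (α + t) b z = pdLift α b z + t := fun z => by unfold pdLift; ring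
    have hsl := pdLift_slope_le (α := α) hb.1 h1 hmono h2 (sub_pos.1 hg).le (by
      unfold lastHalf at hr'
      linarith : _ ≤ (round ((pdLift α b)^[i + m] x) : ℝ) + 1 / 2)
    rw [← hs] at hsl
    rw [Function.iterate_succ_apply', Function.iterate_succ_apply', hshift, hshift,
      add_sub_add_right_eq_sub]
    have hg' := gapLength_pos (α := α) hb hxy (i + (m + 1))
    have hgi := gapLength_pos (α := α) hb hxy i
    refine le_of_mul_le_mul_right ?_ hg
    change _ * gapLength α b x y (i + m) ≤ _ at hsl
    calc _ = (pdLift α b ((pdLift (α + t) b)^[m] w') - pdLift α b ((pdLift (α + t) b)^[m] w)) *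
          gapLength α b x y (i + m) * gapLength α b x y i := by ring
      _ ≤ gapLength α b x y (i + (m + 1)) *
          ((pdLift (α + t) b)^[m] w' - (pdLift (α + t) b)^[m] w) * gapLength α b x y i := by gcongr
      _ = gapLength α b x y (i + (m + 1)) *
          (((pdLift (α + t) b)^[m] w' - (pdLift (α + t) b)^[m] w) * gapLength α b x y i) := by ring
      _ ≤ gapLength α b x y (i + (m + 1)) * (gapLength α b x y (i + m) * (w' - w)) := by gcongr
      _ = _ := by ring

lemma exists_iterate_lastHalf_lt (hb : b ∈ Icc (0 : ℝ) 1)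
    (hgen : ∀ (n : ℕ) (k : ℤ), 2 ^ n * pdPhi α b x ≠ pdPhi α b (1 / 2) + k) (i : ℕ) :
    ∃ m, (pdLift α b)^[m] (lastHalf α b x i) < lastHalf α b x (i + m) := by
  by_contra! H
  have hd := sub_pos.2 (pdPhi_lastHalf_lt hb hgen i)
  obtain ⟨m, hm⟩ := pow_unbounded_of_one_lt
    (1 / (pdPhi α b ((pdLift α b)^[i] x) - pdPhi α b (lastHalf α b x i))) one_lt_two
  rw [div_lt_iff₀ hd] at hm
  have h1 := pdPhi_mono (α := α) hb (H m)
  have h2 := pdPhi_mono (α := α) hb (lt_lastHalf_add_one α b x (i + m)).le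
  rw [pdPhi_lastHalf_add_one, add_comm i m, Function.iterate_add_apply, pdPhi_iterate,
    add_comm m i] at h2
  rw [pdPhi_iterate] at h1
  linarith

lemma exists_perturbation_mem_closure (hb : b ∈ Ico (0 : ℝ) 1) (hxy : x < y)
    (hP : pdPhi α b x = pdPhi α b y)
    (hgen : ∀ (n : ℕ) (k : ℤ), 2 ^ n * pdPhi α b x ≠ pdPhi α b (1 / 2) + k) (i : ℕ) :
    ∃ i' > i,
      ((pdLift α b)^[i'] x - lastHalf α b x i') * gapLength α b x y i ≤
        gapLength α b x y i' * ((pdLift α b)^[i] x - lastHalf α b x i) ∧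
      (gapLength α b x y i' < gapLength α b x y i → ∃ t ≥ 0,
        t * gapLength α b x y i ≤
          gapLength α b x y i' * ((pdLift α b)^[i] x - lastHalf α b x i) ∧
        (α + t, b) ∈ closure trapSet) := by
  classical
  have hb' : b ∈ Icc (0 : ℝ) 1 := ⟨hb.1, hb.2.le⟩
  have hr := iterate_lt_lastHalf_add_one hb' hP hgen
  have hex := exists_iterate_lastHalf_lt hb' hgen i
  obtain ⟨m, hlt, hmin⟩ : ∃ m, (pdLift α b)^[m] (lastHalf α b x i) < lastHalf α b x (i + m) ∧
      ∀ j < m, lastHalf α b x (i + j) ≤ (pdLift α b)^[j] (lastHalf α b x i) :=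
    ⟨Nat.find hex, Nat.find_spec hex, fun j hj => not_lt.1 (Nat.find_min hex hj)⟩
  have hm : 0 < m := by
    refine Nat.pos_of_ne_zero fun h => ?_
    subst h
    exact lt_irrefl _ hlt
  have hmono : ∀ {α' : ℝ} (j : ℕ), Monotone (pdLift α' b)^[j] := fun j => (pdLift_mono hb').iterate j
  have horb : ∀ j, (pdLift α b)^[j] ((pdLift α b)^[i] x) = (pdLift α b)^[i + j] x := fun j => by
    rw [add_comm, Function.iterate_add_apply]
  have hgi := gapLength_pos (α := α) hb hxy i
  set c := lastHalf α b x i with hc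
  set c' := lastHalf α b x (i + m) with hc'
  have hratio := iterate_sub_mul_gapLength_le (α := α) (t := 0) hb hxy hr (lastHalf_le α b x i)
    (i := i) (m := m) fun j hj => by
      rw [add_zero]
      exact ⟨hmin j hj, (horb j).le⟩
  rw [add_zero, horb, ← hc] at hratio
  have hcl' : c' < (pdLift α b)^[i + m] x :=
    (lastHalf_le α b x (i + m)).lt_of_ne fun h => by
      have := pdPhi_lastHalf_lt hb' hgen (i + m)
      rw [h] at this
      exact lt_irrefl _ this
  refine ⟨i + m, by omega, ?_, fun hgap => ?_⟩
  · refine le_trans ?_ hratio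
    gcongr
  · set δ := c' - (pdLift α b)^[m] c with hδ
    have hδ0 : 0 < δ := sub_pos.2 hlt
    have hup : c' ≤ (pdLift (α + δ) b)^[m] c := by
      linarith [iterate_pdLift_add_le (α := α) hb' hδ0.le hm c]
    obtain ⟨t, ht, htc⟩ := intermediate_value_Icc hδ0.le
      (continuous_iterate_pdLift_add α b m c).continuousOn
      (show c' ∈ Icc ((pdLift (α + 0) b)^[m] c) _ from ⟨by rw [add_zero]; exact hlt.le, hup⟩)
    simp only at htc
    refine ⟨t, ht.1, ?_, ?_⟩
    · refine le_trans ?_ hratio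
      gcongr
      linarith [ht.2]
    · have hlow : ∀ j < m, lastHalf α b x (i + j) ≤ (pdLift (α + t) b)^[j] c := fun j hj =>
        (hmin j hj).trans (iterate_pdLift_le hb' ht.1 j c)
      have hhigh : ∀ j < m, (pdLift (α + t) b)^[j] c < (pdLift α b)^[i + j] x := fun j hj => by
        by_contra! h
        have h1 := hmono (α' := α + t) (m - j) h
        rw [← Function.iterate_add_apply, Nat.sub_add_cancel hj.le, htc] at h1
        have h2 := iterate_pdLift_le (α := α) hb' ht.1 (m - j) ((pdLift α b)^[i + j] x)
        rw [← Function.iterate_add_apply, show m - j + (i + j) = i + m by omega] at h2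
        linarith
      have hev : ∀ᶠ w in 𝓝[>] c, ∀ j ∈ Finset.range m,
          (pdLift (α + t) b)^[j] w < (pdLift α b)^[i + j] x :=
        (Filter.eventually_all_finset _).2 fun j hj =>
          ((continuous_iterate_pdLift (α + t) b j).continuousAt.eventually_lt_const
            (hhigh j (Finset.mem_range.1 hj))).filter_mono nhdsWithin_le_nhds
      obtain ⟨w, hw, hcw⟩ := (hev.and self_mem_nhdsWithin).exists
      have hcontr := iterate_sub_mul_gapLength_le (α := α) (t := t) hb hxy hr hcw.le (i := i)
        (m := m) fun j hj => ⟨hlow j hj, (hw j (Finset.mem_range.2 hj)).le⟩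
      rw [htc] at hcontr
      have hk : c' = c + ((round ((pdLift α b)^[i + m] x) - round ((pdLift α b)^[i] x) : ℤ) : ℝ) := by
        rw [hc, hc']
        unfold lastHalf
        push_cast
        ring
      have hlt' : (pdLift (α + t) b)^[m] w < w + (c' - c) := by
        have : gapLength α b x y (i + m) * (w - c) < gapLength α b x y i * (w - c) :=
          mul_lt_mul_of_pos_right hgap (sub_pos.2 hcw)
        have : (pdLift (α + t) b)^[m] w - c' < w - c := by
          refine lt_of_mul_lt_mul_right ?_ hgi.le
          linarith
        linarith
      refine mem_closure_trapSet_of_le hb' hm hcw (htc.trans hk).ge ?_ (Or.inr ?_)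
      · linarith
      · linarith

lemma mem_closure_trapSet_of_generic (hb : b ∈ Ico (0 : ℝ) 1) (hxy : x < y)
    (hP : pdPhi α b x = pdPhi α b y)
    (hwan : ∀ (m n : ℕ) (k : ℤ), m < n → 2 ^ n * pdPhi α b x ≠ 2 ^ m * pdPhi α b x + k)
    (hgen : ∀ (n : ℕ) (k : ℤ), 2 ^ n * pdPhi α b x ≠ pdPhi α b (1 / 2) + k) :
    (α, b) ∈ closure trapSet := by
  rw [← closure_closure, Metric.mem_closure_iff]
  intro ε hε
  choose next hnext hratio hpert using exists_perturbation_mem_closure hb hxy hP hgen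
  set N : ℕ → ℕ := fun k => next^[k] 0 with hN
  have hsucc : ∀ k, N (k + 1) = next (N k) := fun k => Function.iterate_succ_apply' _ _ _
  have hmono : StrictMono N := strictMono_nat_of_lt_succ fun k => hsucc k ▸ hnext (N k)
  have hg : ∀ n, 0 < gapLength α b x y n := gapLength_pos hb hxy
  set R := ((pdLift α b)^[0] x - lastHalf α b x 0) / gapLength α b x y 0 with hR
  have hRN : ∀ k, (pdLift α b)^[N k] x - lastHalf α b x (N k) ≤ R * gapLength α b x y (N k) := by
    intro k
    induction k with
    | zero => exact (div_mul_cancel₀ _ (hg 0).ne').ge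
    | succ k ih =>
      refine le_of_mul_le_mul_right ?_ (hg (N k))
      rw [hsucc]
      calc _ ≤ gapLength α b x y (next (N k)) *
            ((pdLift α b)^[N k] x - lastHalf α b x (N k)) := hratio (N k)
        _ ≤ gapLength α b x y (next (N k)) * (R * gapLength α b x y (N k)) := by
          have := hg (next (N k)); gcongr
        _ = _ := by ring
  have htend := (tendsto_gapLength hb hxy hP hwan).comp hmono.tendsto_atTop
  have hsmall : ∀ᶠ k in atTop, R * gapLength α b x y (N k) < ε := by
    have := htend.const_mul R
    rw [mul_zero] at this
    exact this.eventually_lt_const hε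
  obtain ⟨K, hK⟩ := eventually_atTop.1 hsmall
  obtain ⟨k, hk, hdec⟩ : ∃ k ≥ K, gapLength α b x y (N (k + 1)) < gapLength α b x y (N k) := by
    by_contra! H
    have hle : ∀ k ≥ K, gapLength α b x y (N K) ≤ gapLength α b x y (N k) := fun k hk =>
      Nat.le_induction le_rfl (fun k hk ih => ih.trans (H k hk)) k hk
    exact (hg (N K)).not_ge (ge_of_tendsto htend (eventually_atTop.2 ⟨K, hle⟩))
  rw [hsucc] at hdec
  obtain ⟨t, ht0, ht, hmem⟩ := hpert (N k) hdec
  refine ⟨_, hmem, ?_⟩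
  have htR : t ≤ R * gapLength α b x y (N (k + 1)) := by
    refine le_of_mul_le_mul_right ?_ (hg (N k))
    rw [hsucc]
    calc _ ≤ _ := ht
      _ ≤ gapLength α b x y (next (N k)) * (R * gapLength α b x y (N k)) := by
        have := hg (next (N k)); have := hRN k; gcongr
      _ = _ := by ring
  rw [Prod.dist_eq, dist_self, Real.dist_eq, sub_add_cancel_left, abs_neg, abs_of_nonneg ht0]
  exact max_lt (htR.trans_lt (hK (k + 1) (hk.trans k.le_succ))) hε

lemma mem_closure_trapSet_of_wandering (hb : b ∈ Ico (0 : ℝ) 1) (hxy : x < y)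
    (hP : pdPhi α b x = pdPhi α b y)
    (hwan : ∀ (m n : ℕ) (k : ℤ), m < n → 2 ^ n * pdPhi α b x ≠ 2 ^ m * pdPhi α b x + k) :
    (α, b) ∈ closure trapSet := by
  obtain ⟨N, hN⟩ : ∃ N : ℕ, ∀ n ≥ N, ∀ k : ℤ, 2 ^ n * pdPhi α b x ≠ pdPhi α b (1 / 2) + k := by
    by_contra! H
    obtain ⟨m, -, k, hk⟩ := H 0
    obtain ⟨n, hn, k', hk'⟩ := H (m + 1)
    refine hwan m n (k' - k) hn ?_
    push_cast
    linarith
  refine mem_closure_trapSet_of_generic hb ((pdLift_strictMono (α := α) hb).iterate N hxy) ?_ ?_ ?_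
  · rw [pdPhi_iterate, pdPhi_iterate, hP]
  · intro m n k hmn h
    rw [pdPhi_iterate, ← mul_assoc, ← mul_assoc, ← pow_add, ← pow_add] at h
    exact hwan _ _ k (by omega) h
  · intro n k h
    rw [pdPhi_iterate, ← mul_assoc, ← pow_add] at h
    exact hN _ (by omega) k h

end Wandering

lemma injective_Phi (a : UnitAddCircle) {b : ℝ} (hb : b ∈ Icc (0 : ℝ) 1)
    (h : (a, b) ∉ closure hypSet) : Function.Injective (Phi a b) := by
  rw [Phi_eq]
  set α : ℝ := rep a + if rep a - b / 2 < 0 then 1 else 0 with hα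
  have ha : (α : UnitAddCircle) = a := by
    rw [hα, AddCircle.coe_add, coe_rep]
    split_ifs <;> simp [AddCircle.coe_period]
  have htrap : (α, b) ∉ closure trapSet := fun ht => h (ha ▸ mem_closure_hypSet ht)
  have hb1 : b ∈ Ico (0 : ℝ) 1 := ⟨hb.1, hb.2.lt_of_ne fun h1 => htrap (by
    rw [h1]
    exact mem_closure_trapSet_one α)⟩
  refine Function.Injective.of_lt_imp_ne fun x y hxy hP => htrap ?_
  by_cases hwan : ∀ (m n : ℕ) (k : ℤ), m < n → 2 ^ n * pdPhi α b x ≠ 2 ^ m * pdPhi α b x + k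
  · exact mem_closure_trapSet_of_wandering hb1 hxy hP hwan
  · push Not at hwan
    obtain ⟨m, n, k, hmn, hk⟩ := hwan
    exact mem_closure_trapSet_of_periodic hb1 hxy hP hmn hk

theorem stmt18 (a : UnitAddCircle) (b : ℝ) (hb : b ∈ Set.Icc (0:ℝ) 1)
    (h : (a, b) ∉ closure hypSet) :
    (∃ e : UnitAddCircle ≃ₜ UnitAddCircle, ⇑e = phiMap a b) ∧
    phiMap a b ∘ plpdm a b = Dbl ∘ phiMap a b :=
  ⟨exists_homeomorph_phiMap a b (injective_Phi a hb h), phiMap_comp_plpdm a b⟩
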